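/- Let G be a simple graph with m edges, let I be an independent set of G, let 0 < p < 1, and let Q be a p-random query. Then Pr[Q is independent in G | I ⊆ Q] ≥ (1 − p)^{|Γ_G(I)|} · N_G(p) ≥ (1 − p)^{|Γ_G(I)|} · (1 − mp²). -/

import Mathlib

open Finset
open scoped Classical

/-- The probability that a `p`-random query (each vertex included independently with
probability `p`) equals the given finite set `Q`. -/
noncomputable def qweight {V : Type} [Fintype V] (p : ℝ) (Q : Finset V) : ℝ :=
  p ^ Q.card * (1 - p) ^ (Fintype.card V - Q.card)

/-- The probability that a `p`-random query satisfies the event `A`. -/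
noncomputable def qprob {V : Type} [Fintype V] (p : ℝ) (A : Finset V → Prop) : ℝ :=
  ∑ Q : Finset V, if A Q then qweight p Q else 0

/-- `Q` is an independent set in `G`. -/
def indepIn {V : Type} (G : SimpleGraph V) (Q : Finset V) : Prop :=
  ∀ u ∈ Q, ∀ v ∈ Q, ¬ G.Adj u v

/-- `N_G(p)`: the probability that a `p`-random query is independent in `G`. -/
noncomputable def NG {V : Type} [Fintype V] (G : SimpleGraph V) (p : ℝ) : ℝ :=
  qprob p (fun Q => indepIn G Q)

/-- `Γ_G(S)`: the set of vertices outside `S` adjacent in `G` to some vertex of `S`. -/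
noncomputable def nbrs {V : Type} [Fintype V] (G : SimpleGraph V) (S : Finset V) : Finset V :=
  Finset.univ.filter fun u => u ∉ S ∧ ∃ v ∈ S, G.Adj u v

lemma qweight_nonneg {V : Type} [Fintype V] {p : ℝ} (hp0 : 0 ≤ p) (hp1 : p ≤ 1)
    (Q : Finset V) : 0 ≤ qweight p Q :=
  mul_nonneg (pow_nonneg hp0 _) (pow_nonneg (sub_nonneg.2 hp1) _)

lemma qprob_eq_sum_filter {V : Type} [Fintype V] (p : ℝ) (A : Finset V → Prop) :
    qprob p A = ∑ Q with A Q, qweight p Q :=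
  (sum_filter _ _).symm

lemma qprob_mono {V : Type} [Fintype V] {p : ℝ} (hp0 : 0 ≤ p) (hp1 : p ≤ 1)
    {A B : Finset V → Prop} (h : ∀ Q, A Q → B Q) : qprob p A ≤ qprob p B := by
  refine sum_le_sum fun Q _ => ?_
  have := qweight_nonneg hp0 hp1 Q
  have := h Q
  split_ifs <;> tauto

lemma qprob_true {V : Type} [Fintype V] (p : ℝ) :
    qprob p (fun _ : Finset V => True) = 1 := by
  have h := sum_pow_mul_eq_add_pow p (1 - p) (univ : Finset V)
  rw [powerset_univ] at h
  simpa [qprob, qweight] using h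

lemma qprob_and_add_not {V : Type} [Fintype V] (p : ℝ) (A B : Finset V → Prop) :
    qprob p (fun Q => A Q ∧ B Q) + qprob p (fun Q => ¬ A Q ∧ B Q) = qprob p B := by
  unfold qprob
  rw [← sum_add_distrib]
  refine sum_congr rfl fun Q _ => ?_
  by_cases hA : A Q <;> by_cases hB : B Q <;> simp [hA, hB]

lemma qweight_insert {V : Type} [Fintype V] [DecidableEq V] (p : ℝ) {v : V} {Q : Finset V}
    (hv : v ∉ Q) : (1 - p) * qweight p (insert v Q) = p * qweight p Q := by
  have hc : (insert v Q).card ≤ Fintype.card V := card_le_univ _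
  rw [card_insert_of_notMem hv] at hc
  unfold qweight
  rw [card_insert_of_notMem hv,
    show Fintype.card V - Q.card = (Fintype.card V - (Q.card + 1)) + 1 by omega]
  ring

/-- An event that does not depend on `v` is independent of `v ∈ Q`. -/
lemma qprob_mem_and {V : Type} [Fintype V] [DecidableEq V] (p : ℝ) (v : V)
    (B : Finset V → Prop) (hB : ∀ Q, B (insert v Q) ↔ B Q) :
    qprob p (fun Q => v ∈ Q ∧ B Q) = p * qprob p B := by
  have key : (1 - p) * qprob p (fun Q => v ∈ Q ∧ B Q) =
      p * qprob p (fun Q => v ∉ Q ∧ B Q) := by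
    rw [qprob_eq_sum_filter, qprob_eq_sum_filter, mul_sum, mul_sum]
    refine (sum_bij (fun Q _ => insert v Q) ?_ ?_ ?_ ?_).symm
    · intro Q hQ
      simp_all
    · intro Q hQ R hR h
      simp only [mem_filter, mem_univ, true_and] at hQ hR
      rw [← erase_insert hQ.1, h, erase_insert hR.1]
    · intro Q hQ
      simp only [mem_filter, mem_univ, true_and] at hQ
      refine ⟨Q.erase v, ?_, insert_erase hQ.1⟩
      simp only [mem_filter, mem_univ, true_and]
      exact ⟨notMem_erase v Q, by rw [← hB, insert_erase hQ.1]; exact hQ.2⟩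
    · intro Q hQ
      simp only [mem_filter, mem_univ, true_and] at hQ
      exact (qweight_insert p hQ.1).symm
  have := qprob_and_add_not p (fun Q => v ∈ Q) B
  linear_combination key + p * this

lemma qprob_notMem_and {V : Type} [Fintype V] [DecidableEq V] (p : ℝ) (v : V)
    (B : Finset V → Prop) (hB : ∀ Q, B (insert v Q) ↔ B Q) :
    qprob p (fun Q => v ∉ Q ∧ B Q) = (1 - p) * qprob p B := by
  linear_combination qprob_and_add_not p (fun Q => v ∈ Q) B - qprob_mem_and p v B hB

/-- An event that does not depend on `S` is independent of `S ⊆ Q`. -/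
lemma qprob_subset_and {V : Type} [Fintype V] [DecidableEq V] (p : ℝ) (S : Finset V)
    (B : Finset V → Prop) (hB : ∀ v ∈ S, ∀ Q, B (insert v Q) ↔ B Q) :
    qprob p (fun Q => S ⊆ Q ∧ B Q) = p ^ S.card * qprob p B := by
  induction S using Finset.induction_on with
  | empty => simp
  | insert a S ha ih =>
    simp only [mem_insert, forall_eq_or_imp] at hB
    have h := qprob_mem_and p a (fun Q => S ⊆ Q ∧ B Q) fun Q => by
      rw [hB.1 Q, subset_insert_iff_of_notMem ha]
    simp only [insert_subset_iff, and_assoc]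
    rw [h, ih hB.2, card_insert_of_notMem ha]
    ring

/-- An event that does not depend on `S` is independent of `Q` avoiding `S`. -/
lemma qprob_disjoint_and {V : Type} [Fintype V] [DecidableEq V] (p : ℝ) (S : Finset V)
    (B : Finset V → Prop) (hB : ∀ v ∈ S, ∀ Q, B (insert v Q) ↔ B Q) :
    qprob p (fun Q => Disjoint S Q ∧ B Q) = (1 - p) ^ S.card * qprob p B := by
  induction S using Finset.induction_on with
  | empty => simp
  | insert a S ha ih =>
    simp only [mem_insert, forall_eq_or_imp] at hB
    have h := qprob_notMem_and p a (fun Q => Disjoint S Q ∧ B Q) fun Q => by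
      rw [hB.1 Q, disjoint_insert_right]
      tauto
    simp only [disjoint_insert_left, and_assoc]
    rw [h, ih hB.2, card_insert_of_notMem ha]
    ring

lemma qprob_subset {V : Type} [Fintype V] (p : ℝ) (S : Finset V) :
    qprob p (fun Q => S ⊆ Q) = p ^ S.card := by
  have h := qprob_subset_and p S (fun _ => True) (by simp)
  simpa [qprob_true] using h

lemma indepIn_of_sdiff {V : Type} [Fintype V] [DecidableEq V] {G : SimpleGraph V}
    {I Q : Finset V} (hI : indepIn G I) (hd : Disjoint (nbrs G I) Q)
    (hQ : indepIn G (Q \ (I ∪ nbrs G I))) : indepIn G Q := by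
  have hnbr : ∀ u ∈ Q, ∀ v ∈ I, ¬ G.Adj u v := by
    intro u hu v hv huv
    by_cases huI : u ∈ I
    · exact hI u huI v hv huv
    · exact disjoint_right.1 hd hu (by simpa [nbrs] using ⟨huI, v, hv, huv⟩)
  intro u hu v hv huv
  by_cases huI : u ∈ I
  · exact hnbr v hv u huI huv.symm
  by_cases hvI : v ∈ I
  · exact hnbr u hu v hvI huv
  have hu' := disjoint_right.1 hd hu
  have hv' := disjoint_right.1 hd hv
  exact hQ u (by simp [hu, huI, hu']) v (by simp [hv, hvI, hv']) huv

lemma pow_mul_NG_le_qprob {V : Type} [Fintype V] [DecidableEq V] (G : SimpleGraph V)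
    {I : Finset V} (hI : indepIn G I) {p : ℝ} (hp0 : 0 ≤ p) (hp1 : p ≤ 1) :
    p ^ I.card * ((1 - p) ^ (nbrs G I).card * NG G p) ≤
      qprob p (fun Q => indepIn G Q ∧ I ⊆ Q) := by
  have hmono : NG G p ≤ qprob p (fun Q => indepIn G (Q \ (I ∪ nbrs G I))) :=
    qprob_mono hp0 hp1 fun Q hQ u hu v hv =>
      hQ u (mem_sdiff.1 hu).1 v (mem_sdiff.1 hv).1
  have hdisj : Disjoint I (nbrs G I) := by
    rw [disjoint_right]
    intro u hu
    simp only [nbrs, mem_filter] at hu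
    exact hu.2.1
  have hinv : ∀ v ∈ I ∪ nbrs G I, ∀ Q : Finset V,
      indepIn G (insert v Q \ (I ∪ nbrs G I)) ↔ indepIn G (Q \ (I ∪ nbrs G I)) := by
    intro v hv Q
    rw [insert_sdiff_of_mem _ hv]
  calc p ^ I.card * ((1 - p) ^ (nbrs G I).card * NG G p)
      ≤ p ^ I.card * ((1 - p) ^ (nbrs G I).card *
          qprob p (fun Q => indepIn G (Q \ (I ∪ nbrs G I)))) := by
        have : 0 ≤ 1 - p := sub_nonneg.2 hp1
        gcongr
    _ = qprob p (fun Q => I ⊆ Q ∧ Disjoint (nbrs G I) Q ∧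
          indepIn G (Q \ (I ∪ nbrs G I))) := by
        rw [qprob_subset_and, qprob_disjoint_and]
        · exact fun v hv => hinv v (mem_union_right _ hv)
        · intro v hv Q
          rw [hinv v (mem_union_left _ hv), disjoint_insert_right]
          have := disjoint_left.1 hdisj hv
          tauto
    _ ≤ qprob p (fun Q => indepIn G Q ∧ I ⊆ Q) :=
        qprob_mono hp0 hp1 fun Q ⟨h₁, h₂, h₃⟩ => ⟨indepIn_of_sdiff hI h₂ h₃, h₁⟩

lemma one_sub_card_edgeFinset_mul_le_NG {V : Type} [Fintype V] [DecidableEq V]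
    (G : SimpleGraph V) [DecidableRel G.Adj] {p : ℝ} (hp0 : 0 ≤ p) (hp1 : p ≤ 1) :
    1 - G.edgeFinset.card * p ^ 2 ≤ NG G p := by
  have hcompl := qprob_and_add_not p (fun Q => indepIn G Q) (fun _ => True)
  simp only [and_true, qprob_true] at hcompl
  have hunion : qprob p (fun Q => ¬ indepIn G Q) ≤
      ∑ e ∈ G.edgeFinset, qprob p (fun Q => e.toFinset ⊆ Q) := by
    unfold qprob
    rw [sum_comm]
    refine sum_le_sum fun Q _ => ?_
    have hnn : ∀ A : Finset V → Prop, 0 ≤ if A Q then qweight p Q else 0 := by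
      intro A
      split_ifs
      exacts [qweight_nonneg hp0 hp1 Q, le_rfl]
    split_ifs with h
    · simp only [indepIn, not_forall, not_not] at h
      obtain ⟨u, hu, v, hv, huv⟩ := h
      refine le_trans ?_ (single_le_sum (fun e _ => hnn fun Q => e.toFinset ⊆ Q)
        (SimpleGraph.mem_edgeFinset.2 huv : s(u, v) ∈ G.edgeFinset))
      exact (if_pos (by simp [Sym2.toFinset_mk_eq, insert_subset_iff, hu, hv])).ge
    · exact sum_nonneg fun e _ => hnn fun Q => e.toFinset ⊆ Q
  have hedge : ∑ e ∈ G.edgeFinset, qprob p (fun Q => e.toFinset ⊆ Q) =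
      G.edgeFinset.card * p ^ 2 := by
    rw [← nsmul_eq_mul, ← sum_const]
    refine sum_congr rfl fun e he => ?_
    rw [qprob_subset, Sym2.card_toFinset_of_not_isDiag e
      (G.not_isDiag_of_mem_edgeFinset he)]
  unfold NG
  linarith

theorem stmt16 {V : Type} [Fintype V] [DecidableEq V]
    (G : SimpleGraph V) [DecidableRel G.Adj]
    (m : ℕ) (hm : G.edgeFinset.card = m)
    (I : Finset V) (hI : indepIn G I)
    (p : ℝ) (hp0 : 0 < p) (hp1 : p < 1) :
    (1 - p) ^ (nbrs G I).card * NG G p ≤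
      qprob p (fun Q => indepIn G Q ∧ I ⊆ Q) / qprob p (fun Q => I ⊆ Q) ∧
    (1 - p) ^ (nbrs G I).card * (1 - m * p ^ 2) ≤ (1 - p) ^ (nbrs G I).card * NG G p := by
  subst hm
  constructor
  · rw [qprob_subset, le_div_iff₀ (pow_pos hp0 _), mul_comm]
    exact pow_mul_NG_le_qprob G hI hp0.le hp1.le
  · exact mul_le_mul_of_nonneg_left (one_sub_card_edgeFinset_mul_le_NG G hp0.le hp1.le)
      (pow_nonneg (sub_nonneg.2 hp1.le) _)
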